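/- arXiv:1607.04850 — 5 statements merged into one kernel-verified Lean document; each statement's English description precedes it below -/
import Mathlib

section
/- Let λ₁,…,λₙ be n ≥ 2 distinct elements of a field of characteristic zero and let m ≥ 0 be an integer. Then ∑_{i=1}^n λᵢ^m / ∏_{j≠i}(λᵢ−λⱼ) = h_{m−n+1}(λ₁,…,λₙ), where h_k denotes the complete homogeneous symmetric polynomial of degree k in n variables (with h_k = 0 for k < 0). -/
open Finset

/-- The divided-difference sum over a finset. -/
noncomputable def ddSum {ι F : Type*} [DecidableEq ι] [Field F] (v : ι → F) (s : Finset ι) (m : ℕ) : F :=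
  ∑ i ∈ s, v i ^ m / ∏ j ∈ s.erase i, (v i - v j)

/-- Complete homogeneous sums over a finset. -/
noncomputable def hSum {ι F : Type*} [DecidableEq ι] [Field F] (v : ι → F) (s : Finset ι) (k : ℕ) : F :=
  ∑ t ∈ s.sym k, ((t : Multiset ι).map v).prod

lemma ddSum_insert {ι F : Type*} [DecidableEq ι] [Field F] (v : ι → F) (hv : Function.Injective v)
    (s : Finset ι) (a : ι) (ha : a ∉ s) (m : ℕ) :
    ddSum v (insert a s) (m + 1) = ddSum v s m + v a * ddSum v (insert a s) m := by
  unfold ddSum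
  rw [sum_insert ha, sum_insert ha, mul_add, mul_sum, add_left_comm, ← sum_add_distrib]
  congr 1
  · ring
  · refine sum_congr rfl fun i hi => ?_
    have hia : a ≠ i := fun h => ha (h ▸ hi)
    have h1 : v i - v a ≠ 0 := sub_ne_zero.2 fun h => hia (hv h).symm
    have h2 : ∏ j ∈ s.erase i, (v i - v j) ≠ 0 := prod_ne_zero_iff.2 fun j hj =>
      sub_ne_zero.2 fun h => (mem_erase.1 hj).1 (hv h).symm
    rw [erase_insert_of_ne hia, prod_insert (fun h => ha (mem_of_mem_erase h))]
    field_simp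
    ring

lemma ddSum_zero {ι F : Type*} [DecidableEq ι] [Field F] (v : ι → F) (hv : Function.Injective v)
    (k : ℕ) : ∀ s : Finset ι, s.card = k → ddSum v s 0 = if k = 1 then 1 else 0 := by
  induction k with
  | zero => intro s hs; simp [card_eq_zero.1 hs, ddSum]
  | succ k ih =>
    intro s hs
    rcases Nat.eq_zero_or_pos k with rfl | hk
    · obtain ⟨a, rfl⟩ := card_eq_one.1 hs
      simp [ddSum]
    · obtain ⟨a, ha, b, hb, hab⟩ := one_lt_card.1 (show 1 < s.card by omega)
      have h1 := ddSum_insert v hv (s.erase a) a (notMem_erase a s) 0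
      have h2 := ddSum_insert v hv (s.erase b) b (notMem_erase b s) 0
      rw [insert_erase ha, ih _ (by rw [card_erase_of_mem ha]; omega)] at h1
      rw [insert_erase hb, ih _ (by rw [card_erase_of_mem hb]; omega)] at h2
      have h3 : (v a - v b) * ddSum v s 0 = 0 := by linear_combination h2 - h1
      rw [if_neg (by omega)]
      exact (mul_eq_zero.1 h3).resolve_left (sub_ne_zero.2 fun h => hab (hv h))

lemma hSum_insert {ι F : Type*} [DecidableEq ι] [Field F] (v : ι → F)
    (s : Finset ι) (a : ι) (ha : a ∉ s) (k : ℕ) :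
    hSum v (insert a s) (k + 1) = hSum v s (k + 1) + v a * hSum v (insert a s) k := by
  unfold hSum
  rw [← sum_filter_add_sum_filter_not _ (fun t => a ∉ t), mul_sum]
  congr 1
  · refine sum_congr ?_ fun _ _ => rfl
    ext t
    simp only [mem_filter, mem_sym_iff, mem_insert]
    constructor
    · rintro ⟨h, h'⟩ x hx
      exact (h x hx).resolve_left fun e => h' (e ▸ hx)
    · intro h
      exact ⟨fun x hx => Or.inr (h x hx), fun h' => ha (h a h')⟩
  · symm
    refine sum_bij (fun t _ => a ::ₛ t) ?_ ?_ ?_ ?_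
    · intro t ht
      simp only [mem_filter, mem_sym_iff, mem_insert] at ht ⊢
      refine ⟨fun x hx => ?_, by simp⟩
      rcases Sym.mem_cons.1 hx with h | h
      · exact Or.inl h
      · exact ht x h
    · intro t _ t' _ h
      exact Sym.cons_inj_right a t t' |>.1 h
    · intro t ht
      simp only [mem_filter, mem_sym_iff, mem_insert, not_not] at ht
      refine ⟨t.erase a ht.2, ?_, Sym.cons_erase ht.2⟩
      simp only [mem_sym_iff, mem_insert]
      intro x hx
      exact ht.1 x (Multiset.mem_of_mem_erase hx)
    · intro t _
      rw [Sym.coe_cons, Multiset.map_cons, Multiset.prod_cons]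

lemma hSum_zero {ι F : Type*} [DecidableEq ι] [Field F] (v : ι → F) (s : Finset ι) :
    hSum v s 0 = 1 := by
  unfold hSum
  rw [Finset.sym_zero, sum_singleton]
  rfl

lemma ddSum_eq_hSum {ι F : Type*} [DecidableEq ι] [Field F] (v : ι → F)
    (hv : Function.Injective v) (s : Finset ι) : ∀ m : ℕ,
    ddSum v s m = if m + 1 < s.card then 0 else hSum v s (m + 1 - s.card) := by
  induction s using Finset.induction_on with
  | empty => intro m; simp [ddSum, hSum]
  | insert a s ha ih =>
    intro m
    have hc := card_insert_of_notMem ha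
    induction m with
    | zero =>
      rw [ddSum_zero v hv _ _ rfl, hc]
      rcases Nat.eq_zero_or_pos s.card with h | h
      · rw [if_pos (by omega), if_neg (by omega), show 0 + 1 - (s.card + 1) = 0 by omega, hSum_zero]
      · rw [if_neg (by omega), if_pos (by omega)]
    | succ m ihm =>
      rw [ddSum_insert v hv s a ha, ih, ihm, hc]
      rcases lt_trichotomy (m + 1) s.card with h | h | h
      · rw [if_pos h, if_pos (by omega), if_pos (by omega)]; simp
      · rw [if_neg (by omega), if_pos (by omega), if_neg (by omega)]
        rw [show m + 1 - s.card = 0 by omega, show m + 1 + 1 - (s.card + 1) = 0 by omega,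
          hSum_zero, hSum_zero, mul_zero, add_zero]
      · rw [if_neg (by omega), if_neg (by omega), if_neg (by omega)]
        obtain ⟨d, hd⟩ := Nat.exists_eq_add_of_lt h
        rw [show m + 1 - s.card = d + 1 by omega, show m + 1 - (s.card + 1) = d by omega,
          show m + 1 + 1 - (s.card + 1) = d + 1 by omega, hSum_insert v s a ha]

theorem sum_pow_div_prod_eq_hsymm {F : Type*} [Field F] [CharZero F]
    (n : ℕ) (hn : 2 ≤ n) (m : ℕ) (lam : Fin n → F) (hlam : Function.Injective lam) :
    ∑ i : Fin n, lam i ^ m / ∏ j ∈ Finset.univ.erase i, (lam i - lam j) =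
      (if m + 1 < n then 0
        else MvPolynomial.eval lam (MvPolynomial.hsymm (Fin n) F (m + 1 - n))) := by
  have h := ddSum_eq_hSum lam hlam Finset.univ m
  rw [Finset.card_univ, Fintype.card_fin] at h
  refine h.trans ?_
  congr 1
  simp only [hSum, MvPolynomial.hsymm, map_sum, Finset.sym_univ]
  refine sum_congr rfl fun t _ => ?_
  rw [map_multiset_prod, Multiset.map_map]
  congr 2
  funext i
  simp
end

section
/- Let P(x₁,…,x_k, y₁,…,y_{n−k}) be a polynomial over a field of characteristic zero that is symmetric separately in the x's and in the y's, of total degree at most k(n−k), and let λ₁,…,λₙ be distinct. Then ∑_{I⊂[n], |I|=k} P(λ_I, λ_{Iᶜ}) / ∏_{i∈I} ∏_{j∈Iᶜ}(λ_i−λ_j) = d(k,n)/(k!(n−k)!), where d(k,n) is the coefficient of x₁^{n−1}⋯x_k^{n−1}·y₁^{n−1}⋯y_{n−k}^{n−1} in P(x,y)·∏_{i=1}^k∏_{j≠i}(x_i−x_j)·∏_{i=1}^{n−k}∏_{j≠i}(y_i−y_j)·∏_{i=1}^{n−k}∏_{j=1}^k(y_i−x_j). -/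
open Finset MvPolynomial

theorem aux_coeff_grid {F S : Type*} [Field F] [Fintype S] [DecidableEq S]
    (n : ℕ) (hn : 0 < n) (lam : Fin n → F) (hlam : Function.Injective lam)
    (G : MvPolynomial S F) (hG : G.totalDegree ≤ Fintype.card S * (n - 1)) :
    MvPolynomial.coeff (Finsupp.equivFunOnFinite.symm fun _ : S => n - 1) G =
      ∑ f : S → Fin n, MvPolynomial.eval (fun s => lam (f s)) G /
        ∏ s, ∏ b ∈ Finset.univ.erase (f s), (lam (f s) - lam b) := by
  have one : ∀ m : ℕ, m ≤ n - 1 →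
      ∑ a : Fin n, lam a ^ m / ∏ b ∈ Finset.univ.erase a, (lam a - lam b) =
        if m = n - 1 then 1 else 0 := by
    intro m hm
    have h := Lagrange.coeff_eq_sum (s := (Finset.univ : Finset (Fin n))) (v := lam)
      (hlam.injOn) (P := (Polynomial.X ^ m : Polynomial F)) (by
        rw [Polynomial.degree_X_pow, Finset.card_univ, Fintype.card_fin]
        exact_mod_cast (by omega : m < n))
    simp only [Polynomial.eval_pow, Polynomial.eval_X, Polynomial.coeff_X_pow,
      Finset.card_univ, Fintype.card_fin] at h
    rw [← h]
    simp only [eq_comm]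
  simp only [MvPolynomial.eval_eq', Finset.sum_div]
  rw [Finset.sum_comm]
  have key : ∀ d ∈ G.support, ∑ f : S → Fin n, G.coeff d * (∏ s, lam (f s) ^ d s) /
        ∏ s, ∏ b ∈ Finset.univ.erase (f s), (lam (f s) - lam b) =
      if d = (Finsupp.equivFunOnFinite.symm fun _ : S => n - 1) then G.coeff d else 0 := by
    intro d hd
    have e1 : ∑ f : S → Fin n, G.coeff d * (∏ s, lam (f s) ^ d s) /
        ∏ s, ∏ b ∈ Finset.univ.erase (f s), (lam (f s) - lam b) =
        G.coeff d * ∏ s, ∑ a : Fin n,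
          lam a ^ d s / ∏ b ∈ Finset.univ.erase a, (lam a - lam b) := by
      rw [Finset.prod_univ_sum, Finset.mul_sum, Fintype.piFinset_univ]
      refine Finset.sum_congr rfl fun f _ => ?_
      rw [Finset.prod_div_distrib, mul_div_assoc]
    rw [e1]
    split_ifs with h
    · subst h
      rw [Finset.prod_eq_one, mul_one]
      intro s _
      rw [one _ (by simp)]
      simp
    · have : ∃ s, d s < n - 1 := by
        by_contra! hc
        apply h
        have hle := (MvPolynomial.le_totalDegree hd).trans hG
        rw [Finsupp.sum_fintype _ _ (by simp)] at hle
        have hs : ∑ s : S, d s = ∑ s : S, (n - 1) := by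
          apply le_antisymm
          · simpa using hle
          · exact Finset.sum_le_sum fun s _ => hc s
        have := (Finset.sum_eq_sum_iff_of_le (fun s _ => hc s)).1 hs.symm
        ext s
        simpa using (this s (Finset.mem_univ s)).symm
      obtain ⟨s, hs⟩ := this
      rw [Finset.prod_eq_zero (Finset.mem_univ s), mul_zero]
      rw [one _ hs.le, if_neg hs.ne]
  rw [Finset.sum_congr rfl key, Finset.sum_ite_eq']
  split_ifs with h
  · rfl
  · simpa using h

theorem aux_denom {F : Type*} [Field F] {n k m : ℕ} (lam : Fin n → F)
    (e : Fin k ⊕ Fin m ≃ Fin n) :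
    ∏ s, ∏ b ∈ Finset.univ.erase (e s), (lam (e s) - lam b) =
      (∏ i : Fin k, ∏ j ∈ Finset.univ.erase i, (lam (e (Sum.inl i)) - lam (e (Sum.inl j)))) *
      (∏ i : Fin m, ∏ j ∈ Finset.univ.erase i, (lam (e (Sum.inr i)) - lam (e (Sum.inr j)))) *
      (∏ i : Fin m, ∏ j : Fin k, (lam (e (Sum.inr i)) - lam (e (Sum.inl j)))) *
      ∏ i : Fin k, ∏ j : Fin m, (lam (e (Sum.inl i)) - lam (e (Sum.inr j))) := by
  have h : ∀ s, ∏ b ∈ Finset.univ.erase (e s), (lam (e s) - lam b) =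
      ∏ t, if t = s then 1 else (lam (e s) - lam (e t)) := by
    intro s
    rw [← Equiv.prod_comp e.symm]
    refine Eq.trans ?_ (Finset.prod_erase (a := e s) Finset.univ ?_)
    · refine Finset.prod_congr rfl fun b hb => ?_
      have : e.symm b ≠ s := by
        rintro rfl
        simp at hb
      simp [this]
    · simp
  have h2 : ∀ {p : ℕ} (g : Fin p → F) (i : Fin p),
      ∏ j ∈ Finset.univ.erase i, g j = ∏ j, if j = i then 1 else g j := by
    intro p g i
    rw [← Finset.prod_erase (a := i) (s := Finset.univ)]
    · refine Finset.prod_congr rfl fun b hb => ?_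
      simp [Finset.ne_of_mem_erase hb]
    · simp
  simp only [h, h2, Fintype.prod_sum_type, Sum.inl.injEq, Sum.inr.injEq, reduceCtorEq, if_false,
    Finset.prod_mul_distrib]
  ring

theorem aux_totalDegree {F : Type*} [Field F] {k m : ℕ}
    (P : MvPolynomial (Fin k ⊕ Fin m) F) (hP : P.totalDegree ≤ k * m) :
    (P * (∏ i : Fin k, ∏ j ∈ Finset.univ.erase i, (X (Sum.inl i) - X (Sum.inl j))) *
            (∏ i : Fin m, ∏ j ∈ Finset.univ.erase i, (X (Sum.inr i) - X (Sum.inr j))) *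
            ∏ i : Fin m, ∏ j : Fin k, (X (Sum.inr i) - X (Sum.inl j))).totalDegree
      ≤ (k + m) * (k + m - 1) := by
  have hX : ∀ a b : Fin k ⊕ Fin m, (X a - X b : MvPolynomial _ F).totalDegree ≤ 1 := by
    intro a b
    refine (totalDegree_sub _ _).trans ?_
    simp [totalDegree_X]
  have hprod : ∀ {p q : ℕ} (u : Fin p → Finset (Fin q)) (c : ℕ) (_ : ∀ i, (u i).card = c)
      (a : Fin p → Fin k ⊕ Fin m) (b : Fin q → Fin k ⊕ Fin m),
      (∏ i : Fin p, ∏ j ∈ u i, (X (a i) - X (b j)) : MvPolynomial _ F).totalDegree ≤ p * c := by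
    intro p q u c hu a b
    refine (totalDegree_finsetProd _ _).trans ?_
    refine (Finset.sum_le_card_nsmul _ _ c ?_).trans (by simp)
    intro i _
    refine (totalDegree_finsetProd _ _).trans ?_
    refine (Finset.sum_le_card_nsmul _ _ 1 fun j _ => hX _ _).trans (by simp [hu])
  have h1 := hprod (fun i : Fin k => Finset.univ.erase i) (k - 1)
    (by intro i; simp [Finset.card_erase_of_mem]) Sum.inl Sum.inl
  have h2 := hprod (fun i : Fin m => Finset.univ.erase i) (m - 1)
    (by intro i; simp [Finset.card_erase_of_mem]) Sum.inr Sum.inr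
  have h3 := hprod (fun _ : Fin m => (Finset.univ : Finset (Fin k))) k
    (by intro i; simp) Sum.inr Sum.inl
  refine (totalDegree_mul _ _).trans ?_
  refine (add_le_add ((totalDegree_mul _ _).trans
    (add_le_add ((totalDegree_mul _ _).trans (add_le_add hP h1)) h2)) h3).trans ?_
  rcases k with _ | k
  · simp
  rcases m with _ | m
  · simp
  simp only [Nat.add_sub_cancel]
  have : k + 1 + (m + 1) - 1 = k + m + 1 := by omega
  rw [this]
  apply le_of_eq
  ring

theorem aux_bij {n k : ℕ} (hk : k ≤ n) :
    Function.Bijective (fun x : {s : Finset (Fin n) // s.card = k} ×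
        Equiv.Perm (Fin k) × Equiv.Perm (Fin (n - k)) =>
      (Equiv.sumCongr x.2.1 x.2.2).trans
        (finSumEquivOfFinset x.1.2 (by simp [Finset.card_compl, x.1.2] : x.1.1ᶜ.card = n - k))) := by
  rw [Fintype.bijective_iff_injective_and_card]
  constructor
  · rintro ⟨⟨I, hI⟩, σ, τ⟩ ⟨⟨J, hJ⟩, σ', τ'⟩ h
    have hIJ : I = J := by
      have sub : ∀ (K : Finset (Fin n)) (hK : K.card = k) (ρ : Equiv.Perm (Fin k)),
          (Finset.univ.image fun i => K.orderEmbOfFin hK (ρ i)) = K := by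
        intro K hK ρ
        apply Finset.eq_of_subset_of_card_le
        · intro x hx
          obtain ⟨i, _, rfl⟩ := Finset.mem_image.1 hx
          exact Finset.orderEmbOfFin_mem _ _ _
        · have hinj : Function.Injective (fun i => K.orderEmbOfFin hK (ρ i)) :=
            (K.orderEmbOfFin hK).injective.comp ρ.injective
          rw [Finset.card_image_of_injective _ hinj]
          simp [hK]
      rw [← sub I hI σ, ← sub J hJ σ']
      refine Finset.image_congr fun i _ => ?_
      have := DFunLike.congr_fun h (Sum.inl i)
      simpa using this
    subst hIJ
    have h1 : σ = σ' := by
      refine Equiv.ext fun i => ?_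
      have := DFunLike.congr_fun h (Sum.inl i)
      simpa using this
    have h2 : τ = τ' := by
      refine Equiv.ext fun i => ?_
      have := DFunLike.congr_fun h (Sum.inr i)
      simpa using this
    rw [h1, h2]
  · have e0 : Fin k ⊕ Fin (n - k) ≃ Fin n :=
      finSumFinEquiv.trans (finCongr (by omega))
    rw [Fintype.card_equiv e0]
    simp only [Fintype.card_prod, Fintype.card_perm, Fintype.card_fin, Fintype.card_finset_len,
      Fintype.card_sum]
    rw [← mul_assoc, Nat.choose_mul_factorial_mul_factorial hk]
    congr 1
    omega

theorem sum_doubly_symm_eval_div_prod {F : Type*} [Field F] [CharZero F]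
    (n k : ℕ) (hk0 : 0 < k) (hk : k < n)
    (lam : Fin n → F) (hlam : Function.Injective lam)
    (P : MvPolynomial (Fin k ⊕ Fin (n - k)) F)
    (hPsymm : ∀ (σ : Equiv.Perm (Fin k)) (τ : Equiv.Perm (Fin (n - k))),
      MvPolynomial.rename (Equiv.sumCongr σ τ) P = P)
    (hPdeg : P.totalDegree ≤ k * (n - k)) :
    ∑ I : {s : Finset (Fin n) // s.card = k},
        (MvPolynomial.eval
            (Sum.elim (fun i => lam ((I.1.orderIsoOfFin I.2) i : Fin n))
              (fun j => lam ((I.1ᶜ.orderIsoOfFin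
                (by simp [Finset.card_compl, I.2] : I.1ᶜ.card = n - k)) j : Fin n))) P) /
          ∏ i ∈ I.1, ∏ j ∈ I.1ᶜ, (lam i - lam j) =
      (MvPolynomial.coeff
          (Finsupp.equivFunOnFinite.symm fun _ : Fin k ⊕ Fin (n - k) => n - 1)
          (P * (∏ i : Fin k, ∏ j ∈ Finset.univ.erase i, (X (Sum.inl i) - X (Sum.inl j))) *
            (∏ i : Fin (n - k), ∏ j ∈ Finset.univ.erase i, (X (Sum.inr i) - X (Sum.inr j))) *
            ∏ i : Fin (n - k), ∏ j : Fin k, (X (Sum.inr i) - X (Sum.inl j)))) /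
        ((Nat.factorial k : F) * (Nat.factorial (n - k) : F)) := by
  rw [aux_coeff_grid n (by omega) lam hlam _ (by
    refine (aux_totalDegree P hPdeg).trans (le_of_eq ?_)
    simp only [Fintype.card_sum, Fintype.card_fin]
    rw [show k + (n - k) = n by omega])]
  rw [eq_div_iff (mul_ne_zero (by exact_mod_cast Nat.factorial_ne_zero _)
    (by exact_mod_cast Nat.factorial_ne_zero _))]
  simp only [map_mul, map_prod, map_sub, eval_X]
  -- the summand for an arbitrary assignment of nodes
  set T : (Fin k ⊕ Fin (n - k) → Fin n) → F := fun f =>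
    eval (fun s => lam (f s)) P *
      (∏ i : Fin k, ∏ j ∈ Finset.univ.erase i, (lam (f (Sum.inl i)) - lam (f (Sum.inl j)))) *
      (∏ i : Fin (n - k), ∏ j ∈ Finset.univ.erase i,
        (lam (f (Sum.inr i)) - lam (f (Sum.inr j)))) *
      (∏ i : Fin (n - k), ∏ j : Fin k, (lam (f (Sum.inr i)) - lam (f (Sum.inl j)))) /
      ∏ s, ∏ b ∈ Finset.univ.erase (f s), (lam (f s) - lam b) with hT
  change _ = ∑ f, T f
  have hzero : ∀ f, ¬ Function.Injective f → T f = 0 := by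
    intro f hf
    simp only [Function.Injective, not_forall] at hf
    obtain ⟨a, b, hab, hne⟩ := hf
    simp only [hT]
    rcases a with a | a <;> rcases b with b | b
    · rw [Finset.prod_eq_zero (Finset.mem_univ a) (Finset.prod_eq_zero (i := b)
        (by simpa using fun h => hne (by rw [h])) (by rw [hab, sub_self]))]
      simp
    · rw [Finset.prod_eq_zero (s := Finset.univ) (f := fun i : Fin (n - k) => ∏ j : Fin k,
        (lam (f (Sum.inr i)) - lam (f (Sum.inl j)))) (Finset.mem_univ b)
        (Finset.prod_eq_zero (Finset.mem_univ a) (by rw [hab, sub_self]))]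
      simp
    · rw [Finset.prod_eq_zero (s := Finset.univ) (f := fun i : Fin (n - k) => ∏ j : Fin k,
        (lam (f (Sum.inr i)) - lam (f (Sum.inl j)))) (Finset.mem_univ a)
        (Finset.prod_eq_zero (Finset.mem_univ b) (by rw [hab, sub_self]))]
      simp
    · rw [Finset.prod_eq_zero (s := Finset.univ) (f := fun i : Fin (n - k) =>
        ∏ j ∈ Finset.univ.erase i,
        (lam (f (Sum.inr i)) - lam (f (Sum.inr j)))) (Finset.mem_univ a)
        (Finset.prod_eq_zero (i := b)
        (by simpa using fun h => hne (by rw [h])) (by rw [hab, sub_self]))]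
      simp
  have hequiv : ∑ f, T f = ∑ e : Fin k ⊕ Fin (n - k) ≃ Fin n, T e := by
    symm
    refine Fintype.sum_of_injective (fun e : Fin k ⊕ Fin (n - k) ≃ Fin n => (e : _ → Fin n))
      (DFunLike.coe_injective) _ _ ?_ (fun _ => rfl)
    intro f hf
    apply hzero
    intro hinj
    apply hf
    have hb : Function.Bijective f := by
      rw [Fintype.bijective_iff_injective_and_card]
      refine ⟨hinj, ?_⟩
      simp only [Fintype.card_sum, Fintype.card_fin]
      omega
    exact ⟨Equiv.ofBijective f hb, rfl⟩
  have hTe : ∀ e : Fin k ⊕ Fin (n - k) ≃ Fin n, T e = eval (fun s => lam (e s)) P /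
      ∏ i : Fin k, ∏ j : Fin (n - k), (lam (e (Sum.inl i)) - lam (e (Sum.inr j))) := by
    intro e
    simp only [hT]
    rw [aux_denom]
    have hne : ∀ a b, a ≠ b → lam (e a) - lam (e b) ≠ 0 := fun a b hab =>
      sub_ne_zero.2 fun h => hab (e.injective (hlam h))
    have n1 : (∏ i : Fin k, ∏ j ∈ Finset.univ.erase i,
        (lam (e (Sum.inl i)) - lam (e (Sum.inl j)))) ≠ 0 :=
      Finset.prod_ne_zero_iff.2 fun i _ => Finset.prod_ne_zero_iff.2 fun j hj =>
        hne _ _ (by simpa using (Finset.ne_of_mem_erase hj).symm)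
    have n2 : (∏ i : Fin (n - k), ∏ j ∈ Finset.univ.erase i,
        (lam (e (Sum.inr i)) - lam (e (Sum.inr j)))) ≠ 0 :=
      Finset.prod_ne_zero_iff.2 fun i _ => Finset.prod_ne_zero_iff.2 fun j hj =>
        hne _ _ (by simpa using (Finset.ne_of_mem_erase hj).symm)
    have n3 : (∏ i : Fin (n - k), ∏ j : Fin k,
        (lam (e (Sum.inr i)) - lam (e (Sum.inl j)))) ≠ 0 :=
      Finset.prod_ne_zero_iff.2 fun i _ => Finset.prod_ne_zero_iff.2 fun j hj =>
        hne _ _ (by simp)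
    rw [mul_assoc, mul_assoc, ← mul_assoc (∏ i : Fin k, _), mul_comm (eval _ P),
      mul_div_mul_left _ _ (mul_ne_zero (mul_ne_zero n1 n2) n3)]
  rw [hequiv, ← (aux_bij hk.le).sum_comp (fun e : Fin k ⊕ Fin (n - k) ≃ Fin n => T e),
    Fintype.sum_prod_type, Finset.sum_mul]
  refine Finset.sum_congr rfl fun I _ => ?_
  have hc : I.1ᶜ.card = n - k := by simp [Finset.card_compl, I.2]
  have hterm : ∀ y : Equiv.Perm (Fin k) × Equiv.Perm (Fin (n - k)),
      T ((Equiv.sumCongr y.1 y.2).trans (finSumEquivOfFinset I.2 hc)) =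
      (MvPolynomial.eval
            (Sum.elim (fun i => lam ((I.1.orderIsoOfFin I.2) i : Fin n))
              (fun j => lam ((I.1ᶜ.orderIsoOfFin hc) j : Fin n))) P) /
          ∏ i ∈ I.1, ∏ j ∈ I.1ᶜ, (lam i - lam j) := by
    rintro ⟨σ, τ⟩
    rw [hTe]
    congr 1
    · conv_rhs => rw [← hPsymm σ τ, eval_rename]
      congr 2
      funext s
      rcases s with s | s <;> simp
    · have q : ∀ (K : Finset (Fin n)) (c : ℕ) (hK : K.card = c) (ρ : Equiv.Perm (Fin c))
          (g : Fin n → F), ∏ i : Fin c, g (K.orderEmbOfFin hK (ρ i)) = ∏ i ∈ K, g i := by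
        intro K c hK ρ g
        rw [Equiv.prod_comp ρ (fun i => g (K.orderEmbOfFin hK i))]
        conv_rhs => rw [← Finset.map_orderEmbOfFin_univ K hK, Finset.prod_map]
        rfl
      simp only [Equiv.trans_apply, Equiv.sumCongr_apply, Sum.map_inl, Sum.map_inr,
        finSumEquivOfFinset_inl, finSumEquivOfFinset_inr]
      rw [← q I.1 k I.2 σ]
      refine Finset.prod_congr rfl fun i _ => ?_
      rw [← q I.1ᶜ (n - k) hc τ]
  rw [Finset.sum_congr rfl fun y _ => hterm y]
  simp only [Finset.sum_const, Finset.card_univ, Fintype.card_prod, Fintype.card_perm,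
    Fintype.card_fin, nsmul_eq_mul, Nat.cast_mul]
  rw [mul_comm]
end

section
/- Let P(x₁,…,x_k) be a symmetric polynomial over a field of characteristic zero whose degree in each variable is at most n−k, and let λ₁,…,λₙ be distinct. Then ∑_{I⊂[n], |I|=k} P(λ_I)/∏_{i∈I}∏_{j∈Iᶜ}(λ_i−λ_j) equals the coefficient of x₁^{n−k}⋯x_k^{n−k} in P. -/
open Finset MvPolynomial

namespace SymSum

variable {F : Type*} [Field F]

/-- The denominators of the Lagrange interpolation functional. -/
noncomputable def w {n : ℕ} (lam : Fin n → F) (i : Fin n) : F :=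
  ∏ j ∈ univ.erase i, (lam i - lam j)

/-- The divided difference functional on monomials. -/
noncomputable def L {n : ℕ} (lam : Fin n → F) (m : ℕ) : F := ∑ i, lam i ^ m / w lam i

theorem L_eq {n : ℕ} (lam : Fin n → F) (hlam : Function.Injective lam) (m : ℕ) (hm : m < n) :
    L lam m = if n - 1 = m then 1 else 0 := by
  have h := Lagrange.coeff_eq_sum (s := (univ : Finset (Fin n))) (v := lam) hlam.injOn
    (P := (Polynomial.X : Polynomial F) ^ m) (by simpa using hm)
  simp only [Polynomial.eval_pow, Polynomial.eval_X, card_univ, Fintype.card_fin,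
    Polynomial.coeff_X_pow] at h
  rw [h]; rfl

theorem w_ne {n : ℕ} (lam : Fin n → F) (hlam : Function.Injective lam) (i : Fin n) :
    w lam i ≠ 0 := by
  rw [w, prod_ne_zero_iff]
  intro j hj
  rw [sub_ne_zero]
  exact fun h => (ne_of_mem_erase hj) (hlam h).symm

/-- The reversed Vandermonde determinant. -/
noncomputable def Drev {k : ℕ} (e : Fin k → F) : F := (Matrix.projVandermonde 1 e).det

theorem Drev_eq {k : ℕ} (e : Fin k → F) : Drev e = ∏ a, ∏ b ∈ Ioi a, (e a - e b) := by
  simp [Drev, Matrix.det_projVandermonde]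

theorem Drev_expand {k : ℕ} (e : Fin k → F) :
    Drev e = ∑ σ : Equiv.Perm (Fin k), ((Equiv.Perm.sign σ : ℤ) : F) *
      ∏ a, e a ^ ((σ a).rev : ℕ) := by
  rw [Drev, ← Matrix.det_transpose, Matrix.det_apply']
  simp [Matrix.projVandermonde_apply]

theorem Drev_perm {k : ℕ} (e : Fin k → F) (σ : Equiv.Perm (Fin k)) :
    Drev (fun a => e (σ a)) = ((Equiv.Perm.sign σ : ℤ) : F) * Drev e := by
  rw [Drev, Drev, ← Matrix.det_permute]
  congr 1

theorem offdiag {k : ℕ} (e : Fin k → F) :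
    ∏ a, ∏ b ∈ univ.erase a, (e a - e b) = Drev e * (Matrix.vandermonde e).det := by
  rw [Drev_eq, Matrix.det_vandermonde]
  have h1 : ∏ a : Fin k, ∏ b ∈ Ioi a, (e b - e a) = ∏ a : Fin k, ∏ b ∈ Iio a, (e a - e b) := by
    apply Finset.prod_comm'
    intro x y
    simp
  rw [h1, ← prod_mul_distrib]
  refine prod_congr rfl fun a _ => ?_
  rw [← prod_union]
  · refine prod_congr ?_ fun _ _ => rfl
    ext b
    simp only [mem_erase, mem_univ, and_true, mem_union, mem_Ioi, mem_Iio]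
    constructor
    · intro h; exact (lt_or_gt_of_ne h).symm
    · rintro (h | h)
      · exact h.ne'
      · exact h.ne
  · rw [disjoint_left]
    intro b hb hb2
    simp only [mem_Ioi, mem_Iio] at hb hb2
    exact absurd hb (not_lt.2 hb2.le)

theorem prod_w {n k : ℕ} (lam : Fin n → F) (I : Finset (Fin n)) (hI : I.card = k) :
    (∏ i ∈ I, ∏ j ∈ Iᶜ, (lam i - lam j)) *
      (Drev (fun a => lam (I.orderEmbOfFin hI a)) *
        (Matrix.vandermonde (fun a => lam (I.orderEmbOfFin hI a))).det) =
      ∏ a, w lam (I.orderEmbOfFin hI a) := by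
  have hmap : I = univ.map (I.orderEmbOfFin hI).toEmbedding := by
    rw [← Finset.coe_inj, coe_map, coe_univ, Set.image_univ]
    exact (Finset.range_orderEmbOfFin I hI).symm
  have key : ∀ g : Fin n → F, ∏ i ∈ I, g i = ∏ a, g (I.orderEmbOfFin hI a) := by
    intro g
    conv_lhs => rw [hmap]
    rw [prod_map]; rfl
  rw [← offdiag, key, ← prod_mul_distrib]
  refine prod_congr rfl fun a _ => ?_
  have h2 : ∏ b ∈ univ.erase a, (lam (I.orderEmbOfFin hI a) - lam (I.orderEmbOfFin hI b)) =
      ∏ j ∈ I.erase (I.orderEmbOfFin hI a), (lam (I.orderEmbOfFin hI a) - lam j) := by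
    have : I.erase (I.orderEmbOfFin hI a) =
        (univ.erase a).map (I.orderEmbOfFin hI).toEmbedding := by
      rw [map_erase, ← hmap]; rfl
    rw [this, prod_map]; rfl
  rw [h2, w, ← prod_union]
  · refine prod_congr ?_ fun _ _ => rfl
    ext j
    have := I.orderEmbOfFin_mem hI a
    simp only [mem_union, mem_compl, mem_erase, mem_univ, and_true]
    constructor
    · rintro (h | h)
      · rintro rfl; exact h this
      · exact h.1
    · intro h
      by_cases hj : j ∈ I
      · exact Or.inr ⟨h, hj⟩
      · exact Or.inl hj
  · rw [disjoint_left]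
    intro j hj hj2
    exact (mem_compl.1 hj) (mem_of_mem_erase hj2)

/-- The summand over tuples. -/
noncomputable def G {n k : ℕ} (lam : Fin n → F) (P : MvPolynomial (Fin k) F)
    (f : Fin k → Fin n) : F :=
  eval (fun a => lam (f a)) P * Drev (fun a => lam (f a)) *
    ∏ a, (lam (f a) ^ (a : ℕ) / w lam (f a))

theorem term_eq {n k : ℕ} (lam : Fin n → F) (hlam : Function.Injective lam)
    (P : MvPolynomial (Fin k) F) (hP : P.IsSymmetric) (I : Finset (Fin n)) (hI : I.card = k) :
    (eval (fun a => lam (I.orderEmbOfFin hI a)) P) / ∏ i ∈ I, ∏ j ∈ Iᶜ, (lam i - lam j) =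
      ∑ τ : Equiv.Perm (Fin k), G lam P (fun a => I.orderEmbOfFin hI (τ a)) := by
  have hw : ∏ a, w lam (I.orderEmbOfFin hI a) ≠ 0 :=
    prod_ne_zero_iff.2 fun a _ => w_ne lam hlam _
  have hp := prod_w lam I hI
  have hA : (∏ i ∈ I, ∏ j ∈ Iᶜ, (lam i - lam j)) ≠ 0 := by
    intro h; rw [h, zero_mul] at hp; exact hw hp.symm
  have h1 : ∀ τ : Equiv.Perm (Fin k), G lam P (fun a => I.orderEmbOfFin hI (τ a)) =
      eval (fun a => lam (I.orderEmbOfFin hI a)) P * Drev (fun a => lam (I.orderEmbOfFin hI a)) /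
        (∏ a, w lam (I.orderEmbOfFin hI a)) * (((Equiv.Perm.sign τ : ℤ) : F) *
        ∏ a, Matrix.vandermonde (fun a => lam (I.orderEmbOfFin hI a)) (τ a) a) := by
    intro τ
    have e1 : eval (fun a => lam (I.orderEmbOfFin hI (τ a))) P =
        eval (fun a => lam (I.orderEmbOfFin hI a)) P := by
      conv_rhs => rw [← hP τ, eval_rename]
      rfl
    have e2 : ∏ a, w lam (I.orderEmbOfFin hI (τ a)) = ∏ a, w lam (I.orderEmbOfFin hI a) :=
      Equiv.prod_comp τ (fun a => w lam (I.orderEmbOfFin hI a))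
    rw [G, e1, Drev_perm (fun a => lam (I.orderEmbOfFin hI a)) τ, prod_div_distrib, e2]
    simp only [Matrix.vandermonde_apply]
    ring
  simp_rw [h1]
  rw [← mul_sum, ← Matrix.det_apply', div_mul_eq_mul_div, div_eq_div_iff hA hw, ← hp]
  ring

theorem sum_tuples {n k : ℕ} (g : (Fin k → Fin n) → F)
    (hg : ∀ f, ¬ Function.Injective f → g f = 0) :
    ∑ I : {s : Finset (Fin n) // s.card = k}, ∑ τ : Equiv.Perm (Fin k),
      g (fun a => I.1.orderEmbOfFin I.2 (τ a)) = ∑ f, g f := by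
  rw [← Fintype.sum_prod_type']
  refine Fintype.sum_of_injective
    (fun x : {s : Finset (Fin n) // s.card = k} × Equiv.Perm (Fin k) =>
      (fun a => x.1.1.orderEmbOfFin x.1.2 (x.2 a))) ?_ _ _ ?_ (fun _ => rfl)
  · rintro ⟨⟨I, hI⟩, τ⟩ ⟨⟨J, hJ⟩, ρ⟩ h
    simp only at h
    have hr : ∀ (I : Finset (Fin n)) (hI : I.card = k) (τ : Equiv.Perm (Fin k)),
        Set.range (fun a => I.orderEmbOfFin hI (τ a)) = I := by
      intro I hI τ
      rw [← Finset.range_orderEmbOfFin I hI]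
      exact τ.surjective.range_comp (I.orderEmbOfFin hI)
    have hIJ : I = J := by
      rw [← Finset.coe_inj, ← hr I hI τ, ← hr J hJ ρ, h]
    subst hIJ
    have : τ = ρ := by
      ext a
      have := (I.orderEmbOfFin hI).injective (congrFun h a)
      rw [this]
    rw [this]
  · intro f hf
    apply hg
    intro hinj
    apply hf
    have hI : (univ.image f).card = k := by
      rw [card_image_of_injective _ hinj]; simp
    let t : Fin k → Fin k := fun a =>
      ((univ.image f).orderIsoOfFin hI).symm ⟨f a, mem_image_of_mem _ (mem_univ _)⟩
    have ht : Function.Injective t := by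
      intro a b hab
      have := ((univ.image f).orderIsoOfFin hI).symm.injective hab
      exact hinj (Subtype.ext_iff.1 this)
    refine ⟨⟨⟨univ.image f, hI⟩, Equiv.ofBijective t (Finite.injective_iff_bijective.1 ht)⟩, ?_⟩
    funext a
    simp only [Equiv.ofBijective_apply, t]
    rw [← Finset.coe_orderIsoOfFin_apply, OrderIso.apply_symm_apply]

theorem G_zero {n k : ℕ} (lam : Fin n → F) (P : MvPolynomial (Fin k) F)
    (f : Fin k → Fin n) (hf : ¬ Function.Injective f) : G lam P f = 0 := by
  obtain ⟨a, b, hab, hne⟩ := Function.not_injective_iff.1 hf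
  have : Drev (fun a => lam (f a)) = 0 := by
    rw [Drev]
    apply Matrix.det_zero_of_row_eq hne
    ext c
    simp [Matrix.projVandermonde_apply, hab]
  rw [G, this]; ring

theorem sum_G {n k : ℕ} (lam : Fin n → F) (P : MvPolynomial (Fin k) F) :
    ∑ f, G lam P f = ∑ σ : Equiv.Perm (Fin k), ∑ d ∈ P.support,
      ((Equiv.Perm.sign σ : ℤ) : F) * P.coeff d * ∏ a, L lam (d a + (σ a).rev + a) := by
  have : ∀ f : Fin k → Fin n, G lam P f = ∑ σ : Equiv.Perm (Fin k), ∑ d ∈ P.support,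
      ((Equiv.Perm.sign σ : ℤ) : F) * P.coeff d *
        ∏ a, (lam (f a) ^ (d a + (σ a).rev + a) / w lam (f a)) := by
    intro f
    rw [G, Drev_expand, eval_eq', sum_mul_sum, sum_comm, sum_mul]
    refine sum_congr rfl fun σ _ => ?_
    rw [sum_mul]
    refine sum_congr rfl fun d _ => ?_
    simp only [pow_add, mul_div_assoc, prod_mul_distrib]
    ring
  simp_rw [this]
  rw [sum_comm]
  refine sum_congr rfl fun σ _ => ?_
  rw [sum_comm]
  refine sum_congr rfl fun d _ => ?_
  rw [← mul_sum]
  simp only [L]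
  rw [Fintype.prod_sum]

theorem perm_eq_one {k : ℕ} (σ : Equiv.Perm (Fin k)) (h : ∀ a, σ a ≤ a) : σ = 1 := by
  have key : ∀ a, σ a = a := by
    intro a
    induction a using WellFoundedLT.induction with
    | ind a ih =>
      by_contra hne
      have hlt : σ a < a := lt_of_le_of_ne (h a) hne
      exact hne (σ.injective (ih _ hlt))
  exact Equiv.ext key

end SymSum

open SymSum in
theorem sum_symm_eval_div_prod_eq_coeff {F : Type*} [Field F] [CharZero F]
    (n k : ℕ) (hk0 : 0 < k) (hk : k < n)
    (lam : Fin n → F) (hlam : Function.Injective lam)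
    (P : MvPolynomial (Fin k) F) (hPsymm : P.IsSymmetric)
    (hPdeg : ∀ i : Fin k, P.degreeOf i ≤ n - k) :
    ∑ I : {s : Finset (Fin n) // s.card = k},
        (MvPolynomial.eval (fun i => lam ((I.1.orderIsoOfFin I.2) i : Fin n)) P) /
          ∏ i ∈ I.1, ∏ j ∈ I.1ᶜ, (lam i - lam j) =
      MvPolynomial.coeff (Finsupp.equivFunOnFinite.symm fun _ : Fin k => n - k) P := by
  simp only [Finset.coe_orderIsoOfFin_apply]
  refine (Finset.sum_congr rfl fun I _ => term_eq lam hlam P hPsymm I.1 I.2).trans ?_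
  refine (sum_tuples (G lam P) (G_zero lam P)).trans ?_
  rw [sum_G]
  have hdeg : ∀ d ∈ P.support, ∀ a, d a ≤ n - k := fun d hd a =>
    (monomial_le_degreeOf a hd).trans (hPdeg a)
  rw [Finset.sum_eq_single 1]
  · rw [Finset.sum_eq_single (Finsupp.equivFunOnFinite.symm fun _ : Fin k => n - k)]
    · have : ∀ a : Fin k, L lam (n - k + ((1 : Equiv.Perm (Fin k)) a).rev + a) = 1 := by
        intro a
        have h1 : n - k + (((1 : Equiv.Perm (Fin k)) a).rev : ℕ) + a = n - 1 := by
          simp only [Equiv.Perm.coe_one, id_eq, Fin.val_rev]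
          omega
        rw [h1, L_eq lam hlam _ (by omega), if_pos rfl]
      simp only [Finsupp.equivFunOnFinite_symm_apply_apply, this]
      simp
    · intro d hd hne
      obtain ⟨a, ha⟩ : ∃ a, d a ≠ n - k := by
        by_contra! h
        exact hne (by ext a; simp [h a])
      have := hdeg d hd a
      rw [Finset.prod_eq_zero (mem_univ a), mul_zero]
      simp only [Equiv.Perm.coe_one, id_eq, Fin.val_rev]
      rw [L_eq lam hlam _ (by omega), if_neg (by omega)]
    · intro h
      rw [notMem_support_iff.1 h]; simp
  · intro σ _ hσ
    refine Finset.sum_eq_zero fun d hd => ?_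
    obtain ⟨a, ha⟩ : ∃ a, a < σ a := by
      by_contra! h
      exact hσ (perm_eq_one σ h)
    have := hdeg d hd a
    have ha2 : (a : ℕ) < σ a := ha
    rw [Finset.prod_eq_zero (mem_univ a), mul_zero]
    rw [Fin.val_rev, L_eq lam hlam _ (by omega), if_neg (by omega)]
  · simp
end

section
/- For distinct λ₁,…,λₙ in a field of characteristic zero and any doubly symmetric polynomial P(x₁,…,x_k,y₁,…,y_{n−k}) of total degree strictly less than k(n−k), with 0 < k < n, the sum ∑_{I⊂[n],|I|=k} P(λ_I,λ_{Iᶜ}) / ∏_{i∈I}∏_{j∈Iᶜ}(λ_i−λ_j) = 0. -/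
open Finset MvPolynomial

theorem aux_sum_inj (n : ℕ) (d : Fin n → ℕ) (hd : Function.Injective d) :
    n * (n - 1) / 2 ≤ ∑ i, d i := by
  have h := Finset.sum_range_id_mul_two n
  have h2 : ∑ i ∈ range n, i ≤ ∑ x ∈ univ.image d, x := by
    have hi : Function.Injective fun i => (d i : ℤ) := fun a b h => hd (by simpa using h)
    have := Finset.sum_range_le_sum (s := univ.image fun i => (d i : ℤ)) (c := 0)
      (by intro x hx; simp only [mem_image, mem_univ, true_and] at hx
          obtain ⟨i, rfl⟩ := hx; positivity)
    rw [Finset.card_image_of_injective _ hi, Finset.sum_image hi.injOn] at this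
    rw [Finset.sum_image hd.injOn]
    simp only [card_univ, Fintype.card_fin, zero_add] at this
    zify
    exact this
  rw [Finset.sum_image (by intro a _ b _ h; exact hd h)] at h2
  omega

theorem aux_alt {F : Type*} [Field F] (n : ℕ) (lam : Fin n → F) (Q : MvPolynomial (Fin n) F)
    (hQ : Q.totalDegree < n * (n - 1) / 2) :
    ∑ π : Equiv.Perm (Fin n), ((Equiv.Perm.sign π : ℤ) : F) * eval (lam ∘ π) Q = 0 := by
  simp_rw [eval_eq', Finset.mul_sum]
  rw [Finset.sum_comm]
  refine Finset.sum_eq_zero fun d hd => ?_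
  have hdet : Matrix.det (Matrix.of fun i j : Fin n => lam i ^ d j) = 0 := by
    have hni : ¬ Function.Injective d := by
      intro hi
      have h1 := aux_sum_inj n d hi
      have h2 := le_totalDegree hd
      rw [Finsupp.sum_fintype _ _ (fun _ => rfl)] at h2
      omega
    simp only [Function.Injective, not_forall] at hni
    obtain ⟨i, j, hij, hne⟩ := hni
    exact Matrix.det_zero_of_column_eq hne (fun a => by simp [hij])
  rw [Matrix.det_apply'] at hdet
  simp only [Matrix.of_apply] at hdet
  calc _ = coeff d Q * ∑ π : Equiv.Perm (Fin n), ((Equiv.Perm.sign π : ℤ) : F) * ∏ i, lam (π i) ^ d i := by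
        rw [Finset.mul_sum]
        refine Finset.sum_congr rfl fun π _ => ?_
        simp only [Function.comp]; ring
    _ = 0 := by rw [hdet, mul_zero]

theorem aux_vand {F : Type*} [Field F] (k m : ℕ) (v : Fin (k + m) → F) :
    (Matrix.vandermonde v).det =
      (∏ i : Fin k, ∏ j ∈ Ioi i, (v (Fin.castAdd m j) - v (Fin.castAdd m i))) *
      (∏ i : Fin m, ∏ j ∈ Ioi i, (v (Fin.natAdd k j) - v (Fin.natAdd k i))) *
      ∏ i : Fin k, ∏ j : Fin m, (v (Fin.natAdd k j) - v (Fin.castAdd m i)) := by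
  have key : ∀ (l : ℕ) (f : Fin l → Fin l → F),
      ∏ i : Fin l, ∏ j ∈ Ioi i, f i j = ∏ i : Fin l, ∏ j : Fin l, if i < j then f i j else 1 := by
    intro l f
    refine Finset.prod_congr rfl fun i _ => ?_
    rw [← Finset.prod_filter]
    congr 1; ext; simp
  rw [Matrix.det_vandermonde, key, key, key, Fin.prod_univ_add]
  have h1 : ∀ (i : Fin k) (j : Fin m), Fin.castAdd m i < Fin.natAdd k j := by
    intro i j; rw [Fin.lt_def]; simp; omega
  have h2 : ∀ (i : Fin k) (j : Fin m), ¬ Fin.natAdd k j < Fin.castAdd m i := by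
    intro i j; exact not_lt.2 (h1 i j).le
  have h3 : ∀ (i j : Fin k), Fin.castAdd m i < Fin.castAdd m j ↔ i < j := by
    intro i j; rw [Fin.lt_def, Fin.lt_def]; simp
  have h4 : ∀ (i j : Fin m), Fin.natAdd k i < Fin.natAdd k j ↔ i < j := by
    intro i j; rw [Fin.lt_def, Fin.lt_def]; simp
  simp only [Fin.prod_univ_add, h1, h2, h3, h4, if_true, if_false, Finset.prod_const_one, one_mul,
    Finset.prod_mul_distrib]
  ring

theorem aux_deg {F : Type*} [Field F] (k n : ℕ) (g : Fin k → Fin n) :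
    (∏ i : Fin k, ∏ j ∈ Ioi i, (X (g j) - X (g i) : MvPolynomial (Fin n) F)).totalDegree
      ≤ k * (k - 1) / 2 := by
  refine (totalDegree_finsetProd _ _).trans ?_
  calc _ ≤ ∑ i : Fin k, (k - 1 - (i:ℕ)) := by
        refine Finset.sum_le_sum fun i _ => ?_
        refine (totalDegree_finsetProd _ _).trans ?_
        rw [← Fin.card_Ioi, Finset.card_eq_sum_ones]
        refine Finset.sum_le_sum fun j _ => ?_
        refine (totalDegree_sub _ _).trans ?_
        simp
    _ = k * (k - 1) / 2 := by
        rw [Fin.sum_univ_eq_sum_range (fun i => k - 1 - i), Finset.sum_range_reflect (fun i => i),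
          Finset.sum_range_id]

theorem aux_perm {F : Type*} [Field F] (k m : ℕ) (lam : Fin (k + m) → F)
    (hlam : Function.Injective lam) (P : MvPolynomial (Fin k ⊕ Fin m) F)
    (hP : P.totalDegree < k * m) :
    ∑ π : Equiv.Perm (Fin (k + m)), eval (fun s => lam (π (finSumFinEquiv s))) P /
      ∏ i : Fin k, ∏ j : Fin m,
        (lam (π (finSumFinEquiv (.inl i))) - lam (π (finSumFinEquiv (.inr j)))) = 0 := by
  set Q : MvPolynomial (Fin (k + m)) F := rename finSumFinEquiv P *
    (∏ i : Fin k, ∏ j ∈ Ioi i, (X (Fin.castAdd m j) - X (Fin.castAdd m i))) *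
      (∏ i : Fin m, ∏ j ∈ Ioi i, (X (Fin.natAdd k j) - X (Fin.natAdd k i))) with hQ
  have hQd : Q.totalDegree < (k + m) * (k + m - 1) / 2 := by
    have h1 := aux_deg (F := F) k (k+m) (Fin.castAdd m)
    have h2 := aux_deg (F := F) m (k+m) (Fin.natAdd k)
    have h3 := totalDegree_rename_le (finSumFinEquiv (m := k) (n := m)) P
    have h4 : Q.totalDegree ≤ _ := (totalDegree_mul _ _).trans
      (Nat.add_le_add (totalDegree_mul _ _) le_rfl)
    have e : (k + m) * (k + m - 1) / 2 = k * m + k * (k - 1) / 2 + m * (m - 1) / 2 := by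
      simp only [← Nat.choose_two_right]
      clear * -
      induction m with
      | zero => simp
      | succ m ih =>
        have h1 := Nat.choose_succ_succ (k + m) 1
        have h2 := Nat.choose_succ_succ m 1
        simp only [Nat.choose_one_right, Nat.succ_eq_add_one, Nat.reduceAdd] at h1 h2
        rw [← add_assoc, h1, h2, ih]; ring
    omega
  have hs := aux_alt _ lam Q hQd
  set V := (Matrix.vandermonde lam).det with hV
  have hV0 : V ≠ 0 := Matrix.det_vandermonde_ne_zero_iff.2 hlam
  have : ∀ π : Equiv.Perm (Fin (k + m)), eval (fun s => lam (π (finSumFinEquiv s))) P /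
      ∏ i : Fin k, ∏ j : Fin m,
        (lam (π (finSumFinEquiv (.inl i))) - lam (π (finSumFinEquiv (.inr j)))) =
      ((∏ i : Fin k, ∏ j : Fin m, (-1 : F)) / V) *
       (((Equiv.Perm.sign π : ℤ) : F) * eval (lam ∘ π) Q) := by
    intro π
    have hp : (Matrix.vandermonde (lam ∘ π)).det = ((Equiv.Perm.sign π : ℤ) : F) * V := by
      rw [hV, ← Matrix.det_permute]; rfl
    have hv := aux_vand k m (lam ∘ π)
    have hn : (Matrix.vandermonde (lam ∘ π)).det ≠ 0 :=
      Matrix.det_vandermonde_ne_zero_iff.2 (hlam.comp π.injective)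
    have hsgn : ((Equiv.Perm.sign π : ℤ) : F) * ((Equiv.Perm.sign π : ℤ) : F) = 1 := by
      rcases Int.units_eq_one_or (Equiv.Perm.sign π) with h | h <;> simp [h]
    have hsgn1 : (∏ i : Fin k, ∏ j : Fin m, (-1 : F)) * (∏ i : Fin k, ∏ j : Fin m, (-1 : F)) = 1 := by
      simp only [← Finset.prod_mul_distrib]
      simp
    have hden : ∏ i : Fin k, ∏ j : Fin m,
        (lam (π (finSumFinEquiv (.inl i))) - lam (π (finSumFinEquiv (.inr j)))) =
        (∏ i : Fin k, ∏ j : Fin m, (-1 : F)) * ∏ i : Fin k, ∏ j : Fin m,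
          ((lam ∘ π) (Fin.natAdd k j) - (lam ∘ π) (Fin.castAdd m i)) := by
      simp only [← Finset.prod_mul_distrib]
      simp
    have hev : eval (lam ∘ π) Q = eval (fun s => lam (π (finSumFinEquiv s))) P *
      (∏ i : Fin k, ∏ j ∈ Ioi i, ((lam ∘ π) (Fin.castAdd m j) - (lam ∘ π) (Fin.castAdd m i))) *
      (∏ i : Fin m, ∏ j ∈ Ioi i, ((lam ∘ π) (Fin.natAdd k j) - (lam ∘ π) (Fin.natAdd k i))) := by
      rw [hQ]
      simp only [map_mul, map_prod, map_sub, eval_X, eval_rename]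
      rfl
    rw [hden, hev]
    generalize (∏ i : Fin k, ∏ j : Fin m, (-1 : F)) = ε at *
    generalize ((Equiv.Perm.sign π : ℤ) : F) = σ at *
    rw [hv] at hn hp
    generalize (∏ i : Fin k, ∏ j ∈ Ioi i, ((lam ∘ π) (Fin.castAdd m j) - (lam ∘ π) (Fin.castAdd m i))) = A at *
    generalize (∏ i : Fin m, ∏ j ∈ Ioi i, ((lam ∘ π) (Fin.natAdd k j) - (lam ∘ π) (Fin.natAdd k i))) = B at *
    generalize (∏ i : Fin k, ∏ j : Fin m,
          ((lam ∘ π) (Fin.natAdd k j) - (lam ∘ π) (Fin.castAdd m i))) = C at *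
    generalize eval (fun s => lam (π (finSumFinEquiv s))) P = p at *
    have hC : C ≠ 0 := right_ne_zero_of_mul hn
    have hε : ε ≠ 0 := left_ne_zero_of_mul_eq_one hsgn1
    have hVe : V = σ * (A * B * C) := by rw [hp, ← mul_assoc, hsgn, one_mul]
    rw [div_eq_iff (mul_ne_zero hε hC), div_mul_eq_mul_div, div_mul_eq_mul_div, eq_div_iff hV0, hVe]
    linear_combination (-(p * σ * A * B * C)) * hsgn1
  simp_rw [this]
  rw [← Finset.mul_sum, hs, mul_zero]

theorem aux_equiv {F : Type*} [Field F] (k m n : ℕ) (h : k + m = n) (lam : Fin n → F)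
    (hlam : Function.Injective lam) (P : MvPolynomial (Fin k ⊕ Fin m) F)
    (hP : P.totalDegree < k * m) :
    ∑ e : Fin k ⊕ Fin m ≃ Fin n, eval (fun s => lam (e s)) P /
      ∏ i : Fin k, ∏ j : Fin m, (lam (e (.inl i)) - lam (e (.inr j))) = 0 := by
  subst h
  rw [← aux_perm k m lam hlam P hP]
  symm
  refine Fintype.sum_equiv (Equiv.equivCongr finSumFinEquiv.symm (Equiv.refl _)) _ _ fun π => ?_
  simp [Equiv.equivCongr]

theorem sum_doubly_symm_eval_div_prod_eq_zero {F : Type*} [Field F] [CharZero F]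
    (n k : ℕ) (hk0 : 0 < k) (hk : k < n)
    (lam : Fin n → F) (hlam : Function.Injective lam)
    (P : MvPolynomial (Fin k ⊕ Fin (n - k)) F)
    (hPsymm : ∀ (σ : Equiv.Perm (Fin k)) (τ : Equiv.Perm (Fin (n - k))),
      MvPolynomial.rename (Equiv.sumCongr σ τ) P = P)
    (hPdeg : P.totalDegree < k * (n - k)) :
    ∑ I : {s : Finset (Fin n) // s.card = k},
        (MvPolynomial.eval
            (Sum.elim (fun i => lam ((I.1.orderIsoOfFin I.2) i : Fin n))
              (fun j => lam ((I.1ᶜ.orderIsoOfFin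
                (by simp [Finset.card_compl, I.2] : I.1ᶜ.card = n - k)) j : Fin n))) P) /
          ∏ i ∈ I.1, ∏ j ∈ I.1ᶜ, (lam i - lam j) = 0 := by
  have hc : ∀ I : {s : Finset (Fin n) // s.card = k}, I.1ᶜ.card = n - k := fun I => by
    simp [Finset.card_compl, I.2]
  have h0 := aux_equiv k (n - k) n (by omega) lam hlam P hPdeg
  let E : {s : Finset (Fin n) // s.card = k} → (Fin k ⊕ Fin (n - k) ≃ Fin n) :=
    fun I => finSumEquivOfFinset I.2 (hc I)
  have hEl : ∀ I i, E I (.inl i) = (I.1.orderIsoOfFin I.2) i := fun I i => by simp [E]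
  have hEr : ∀ I i, E I (.inr i) = (I.1ᶜ.orderIsoOfFin (hc I)) i := fun I i => by simp [E]
  have hmem : ∀ I i, E I (.inl i) ∈ I.1 := fun I i => by rw [hEl]; exact Subtype.prop _
  have hmem' : ∀ I i, E I (.inr i) ∉ I.1 := fun I i => by
    rw [hEr]; exact Finset.mem_compl.1 (Subtype.prop _)
  let Φ : {s : Finset (Fin n) // s.card = k} × (Equiv.Perm (Fin k) × Equiv.Perm (Fin (n - k))) →
    (Fin k ⊕ Fin (n - k) ≃ Fin n) := fun t => (Equiv.sumCongr t.2.1 t.2.2).trans (E t.1)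
  have hΦI : ∀ t x, x ∈ t.1.1 ↔ ∃ i, Φ t (.inl i) = x := by
    intro t x
    constructor
    · intro hx
      obtain ⟨s, rfl⟩ := (Φ t).surjective x
      rcases s with i | j
      · exact ⟨i, rfl⟩
      · exact absurd hx (hmem' t.1 _)
    · rintro ⟨i, rfl⟩
      exact hmem t.1 _
  have hΦ : Function.Bijective Φ := by
    constructor
    · intro t t' htt
      have hI : t.1 = t'.1 := by
        apply Subtype.ext
        ext x
        rw [hΦI, hΦI, htt]
      obtain ⟨I, σ, τ⟩ := t
      obtain ⟨I', σ', τ'⟩ := t'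
      obtain rfl : I = I' := hI
      have h1 : ∀ s, Equiv.sumCongr σ τ s = Equiv.sumCongr σ' τ' s := fun s =>
        (E I).injective (DFunLike.congr_fun htt s)
      have hσ : σ = σ' := by ext i; have := h1 (.inl i); simp at this; simp [this]
      have hτ : τ = τ' := by ext i; have := h1 (.inr i); simp at this; simp [this]
      rw [hσ, hτ]
    · intro e
      let I : {s : Finset (Fin n) // s.card = k} :=
        ⟨univ.image fun i => e (.inl i), by
          have hi : Function.Injective fun i => e (.inl i) := e.injective.comp Sum.inl_injective
          rw [Finset.card_image_of_injective _ hi]; simp⟩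
      have hp : e.trans (E I).symm ∈ (Equiv.Perm.sumCongrHom (Fin k) (Fin (n - k))).range := by
        apply Equiv.Perm.mem_sumCongrHom_range_of_perm_mapsTo_inl
        rintro _ ⟨i, rfl⟩
        simp only [Equiv.trans_apply]
        rcases hh : (E I).symm (e (.inl i)) with a | b
        · exact ⟨a, rfl⟩
        · exfalso
          rw [Equiv.symm_apply_eq] at hh
          refine hmem' I b ?_
          rw [← hh]
          simp [I]
      obtain ⟨⟨σ, τ⟩, hst⟩ := hp
      refine ⟨⟨I, σ, τ⟩, ?_⟩
      ext1 s
      have := DFunLike.congr_fun hst s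
      rw [Equiv.trans_apply, Equiv.eq_symm_apply] at this
      exact this
  rw [← Function.Bijective.sum_comp hΦ, Fintype.sum_prod_type] at h0
  have hterm : ∀ I (στ : Equiv.Perm (Fin k) × Equiv.Perm (Fin (n - k))),
      eval (fun s => lam (Φ (I, στ) s)) P /
      ∏ i : Fin k, ∏ j : Fin (n - k), (lam (Φ (I, στ) (.inl i)) - lam (Φ (I, στ) (.inr j))) =
      (MvPolynomial.eval
            (Sum.elim (fun i => lam ((I.1.orderIsoOfFin I.2) i : Fin n))
              (fun j => lam ((I.1ᶜ.orderIsoOfFin (hc I)) j : Fin n))) P) /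
          ∏ i ∈ I.1, ∏ j ∈ I.1ᶜ, (lam i - lam j) := by
    rintro I ⟨σ, τ⟩
    congr 1
    · conv_rhs => rw [← hPsymm σ τ, eval_rename]
      congr 2
      funext s
      rcases s with i | j
      · exact congrArg lam (hEl I _)
      · exact congrArg lam (hEr I _)
    · have hI : I.1 = univ.image fun i => Φ (I, σ, τ) (.inl i) := by
        ext x; simp [hΦI (I, σ, τ) x]
      have hIc : I.1ᶜ = univ.image fun j => Φ (I, σ, τ) (.inr j) := by
        ext x
        rw [Finset.mem_compl, hΦI (I, σ, τ) x]
        obtain ⟨s, rfl⟩ := (Φ (I, σ, τ)).surjective x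
        rcases s with i | j <;> simp
      have i1 : Function.Injective fun i => Φ (I, σ, τ) (.inl i) :=
        (Φ (I, σ, τ)).injective.comp Sum.inl_injective
      have i2 : Function.Injective fun i => Φ (I, σ, τ) (.inr i) :=
        (Φ (I, σ, τ)).injective.comp Sum.inr_injective
      rw [hIc]
      conv_rhs => rw [hI]
      rw [Finset.prod_image i1.injOn]
      refine Finset.prod_congr rfl fun i _ => ?_
      rw [Finset.prod_image i2.injOn]
  simp_rw [hterm] at h0
  simp only [Finset.sum_const, nsmul_eq_mul, ← Finset.mul_sum] at h0
  refine (mul_eq_zero.1 h0).resolve_left ?_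
  refine Nat.cast_ne_zero.2 ?_
  exact Finset.card_ne_zero_of_mem (Finset.mem_univ 1)
end

section
/- The coefficient of y₁^{n−1}⋯y_{n−k}^{n−1} in the polynomial ∏_{i=1}^{n−k}∏_{j≠i}(y_i−y_j) · ∏_{i=1}^{n−k}∏_{j=1}^k(y_i−x_j) (a polynomial in y₁,…,y_{n−k} with coefficients in the ring of polynomials in x₁,…,x_k) equals the constant (n−k)!. -/
open Finset MvPolynomial

/-- Replacing linear factors `X - c` by `X` does not change top-degree coefficients. -/
lemma cpd_top {R σ ι : Type*} [CommRing R] [DecidableEq ι] (f : ι → σ) (c : ι → R)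
    (d : σ →₀ ℕ) (s : Finset ι) : ∀ (D : ℕ) (P : MvPolynomial σ R), P.totalDegree ≤ D →
      D + s.card ≤ d.degree →
      coeff d (P * ∏ t ∈ s, (X (f t) - C (c t))) = coeff d (P * ∏ t ∈ s, X (f t)) := by
  induction s using Finset.induction_on with
  | empty => intro D P _ _; simp
  | insert a s ha ih =>
    intro D P hP hd
    rw [card_insert_of_notMem ha] at hd
    rw [prod_insert ha, prod_insert ha, ← mul_assoc, ih (D + 1) _ _ (by omega)]
    · have h0 : coeff d (P * ∏ t ∈ s, X (f t)) = 0 := by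
        apply coeff_eq_zero_of_totalDegree_lt
        have h1 : (∏ t ∈ s, (X (f t) : MvPolynomial σ R)).totalDegree ≤ s.card := by
          refine (totalDegree_finsetProd _ _).trans ?_
          refine (sum_le_card_nsmul _ _ 1 ?_).trans (by simp)
          intro t _
          exact (isHomogeneous_X R (f t)).totalDegree_le
        have h2 := totalDegree_mul P (∏ t ∈ s, X (f t))
        have h3 : ∑ i ∈ d.support, d i = d.degree := rfl
        omega
      have : P * (X (f a) - C (c a)) * ∏ t ∈ s, X (f t)
          = P * (X (f a) * ∏ t ∈ s, X (f t)) - C (c a) * (P * ∏ t ∈ s, X (f t)) := by ring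
      rw [this, coeff_sub, coeff_C_mul, h0, mul_zero, sub_zero]
    · refine (totalDegree_mul _ _).trans (Nat.add_le_add hP ?_)
      refine (totalDegree_sub_C_le _ _).trans ?_
      exact (isHomogeneous_X R (f a)).totalDegree_le

lemma cpd_split {S : Type*} [CommRing S] {m : ℕ} (y : Fin m → S) :
    ∏ i : Fin m, ∏ j ∈ univ.erase i, (y i - y j)
      = (Matrix.projVandermonde y 1).det * (Matrix.projVandermonde 1 y).det := by
  rw [Matrix.det_projVandermonde, Matrix.det_projVandermonde]
  have h : ∀ i : Fin m, ∏ j ∈ univ.erase i, (y i - y j)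
      = (∏ j ∈ Iio i, (y i - y j)) * ∏ j ∈ Ioi i, (y i - y j) := by
    intro i
    rw [← prod_union]
    · congr 1
      ext j
      simp [lt_or_lt_iff_ne]
    · rw [Finset.disjoint_left]
      intro j; simp only [mem_Iio, mem_Ioi]; exact fun a b => lt_asymm a b
  simp_rw [h, prod_mul_distrib]
  congr 1
  · rw [prod_comm' (t' := univ) (s' := fun j => Ioi j)]
    · simp
    · simp
  · simp

lemma cpd_monomial {R : Type*} [CommRing R] {m : ℕ} (e : Fin m → ℕ) :
    ∏ i, (X i : MvPolynomial (Fin m) R) ^ e i = monomial (Finsupp.equivFunOnFinite.symm e) 1 := by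
  rw [monomial_eq, C_1, one_mul, Finsupp.prod_fintype _ _ (by simp)]
  simp

lemma cpd_main {R : Type*} [CommRing R] (m k : ℕ) :
    coeff (Finsupp.equivFunOnFinite.symm fun _ : Fin m => (m - 1) + k)
      ((Matrix.projVandermonde X 1).det * (Matrix.projVandermonde 1 X).det *
        ∏ i : Fin m, (X i : MvPolynomial (Fin m) R) ^ k) = (m.factorial : R) := by
  have h1 : (Matrix.projVandermonde (X : Fin m → MvPolynomial (Fin m) R) 1).det
      = ∑ s : Equiv.Perm (Fin m), C ((Equiv.Perm.sign s : ℤ) : R) *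
          ∏ i, X i ^ (s i : ℕ) := by
    rw [← Matrix.det_transpose, Matrix.det_apply']
    simp [Matrix.transpose_apply, Matrix.projVandermonde_apply]
  have h2 : (Matrix.projVandermonde 1 (X : Fin m → MvPolynomial (Fin m) R)).det
      = ∑ s : Equiv.Perm (Fin m), C ((Equiv.Perm.sign s : ℤ) : R) *
          ∏ i, X i ^ ((s i).rev : ℕ) := by
    rw [← Matrix.det_transpose, Matrix.det_apply']
    simp [Matrix.transpose_apply, Matrix.projVandermonde_apply]
  rw [h1, h2, sum_mul_sum, sum_mul, coeff_sum]
  have h3 : ∀ s : Equiv.Perm (Fin m),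
      coeff (Finsupp.equivFunOnFinite.symm fun _ : Fin m => (m - 1) + k)
        ((∑ t : Equiv.Perm (Fin m), C ((Equiv.Perm.sign s : ℤ) : R) * (∏ i, X i ^ (s i : ℕ)) *
          (C ((Equiv.Perm.sign t : ℤ) : R) * ∏ i, X i ^ ((t i).rev : ℕ))) *
          ∏ i : Fin m, (X i : MvPolynomial (Fin m) R) ^ k) = 1 := by
    intro s
    rw [sum_mul, coeff_sum]
    have h4 : ∀ t : Equiv.Perm (Fin m),
        coeff (Finsupp.equivFunOnFinite.symm fun _ : Fin m => (m - 1) + k)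
          (C ((Equiv.Perm.sign s : ℤ) : R) * (∏ i, X i ^ (s i : ℕ)) *
          (C ((Equiv.Perm.sign t : ℤ) : R) * ∏ i, X i ^ ((t i).rev : ℕ)) *
          ∏ i : Fin m, (X i : MvPolynomial (Fin m) R) ^ k) = if t = s then 1 else 0 := by
      intro t
      have h5 : C ((Equiv.Perm.sign s : ℤ) : R) * (∏ i, X i ^ (s i : ℕ)) *
          (C ((Equiv.Perm.sign t : ℤ) : R) * ∏ i, X i ^ ((t i).rev : ℕ)) *
          ∏ i : Fin m, (X i : MvPolynomial (Fin m) R) ^ k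
          = C (((Equiv.Perm.sign s : ℤ) : R) * ((Equiv.Perm.sign t : ℤ) : R)) *
            ∏ i, X i ^ ((s i : ℕ) + ((t i).rev : ℕ) + k) := by
        simp_rw [pow_add, prod_mul_distrib, C_mul]
        ring
      rw [h5, cpd_monomial, coeff_C_mul, coeff_monomial]
      have h6 : (Finsupp.equivFunOnFinite.symm (fun i => (s i : ℕ) + ((t i).rev : ℕ) + k)
          = Finsupp.equivFunOnFinite.symm fun _ : Fin m => (m - 1) + k) ↔ t = s := by
        rw [Finsupp.equivFunOnFinite.symm.injective.eq_iff, funext_iff, Equiv.ext_iff]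
        refine forall_congr' fun i => ?_
        rw [Fin.ext_iff, Fin.val_rev]
        have := (t i).isLt
        omega
      by_cases hts : t = s
      · rw [if_pos (h6.2 hts), if_pos hts, hts, mul_one, ← Int.cast_mul, ← Units.val_mul,
          Int.units_mul_self]
        simp
      · rw [if_neg (fun h => hts (h6.1 h)), if_neg hts, mul_zero]
    simp_rw [h4]
    simp
  simp_rw [h3]
  simp [Fintype.card_perm]

theorem coeff_prod_differences_mixed {F : Type*} [Field F] [CharZero F]
    (n k : ℕ) (hk0 : 0 < k) (hk : k < n) :
    MvPolynomial.coeff (Finsupp.equivFunOnFinite.symm fun _ : Fin (n - k) => n - 1)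
        ((∏ i : Fin (n - k), ∏ j ∈ Finset.univ.erase i, (X i - X j)) *
            ∏ i : Fin (n - k), ∏ j : Fin k,
              (X i - C (X j)) :
          MvPolynomial (Fin (n - k)) (MvPolynomial (Fin k) F)) =
      (Nat.factorial (n - k) : MvPolynomial (Fin k) F) := by
  obtain ⟨m, hm⟩ : ∃ m, m = n - k := ⟨_, rfl⟩
  rw [← hm]
  have hn : n - 1 = (m - 1) + k := by omega
  rw [hn]
  have key := cpd_top (R := MvPolynomial (Fin k) F) (σ := Fin m) (ι := Fin m × Fin k)
    (fun t => t.1) (fun t => X t.2) (Finsupp.equivFunOnFinite.symm fun _ : Fin m => (m - 1) + k)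
    univ (m * (m - 1)) (∏ i : Fin m, ∏ j ∈ Finset.univ.erase i, (X i - X j)) ?_ ?_
  · rw [Fintype.prod_prod_type, Fintype.prod_prod_type] at key
    rw [key, cpd_split]
    simpa using cpd_main (R := MvPolynomial (Fin k) F) m k
  · refine IsHomogeneous.totalDegree_le ?_
    have h := IsHomogeneous.prod (R := MvPolynomial (Fin k) F) (univ : Finset (Fin m))
      (fun i => ∏ j ∈ Finset.univ.erase i, (X i - X j)) (fun i => ∑ j ∈ univ.erase i, 1)
      (fun i _ => IsHomogeneous.prod _ _ _ fun j _ => (isHomogeneous_X _ i).sub (isHomogeneous_X _ j))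
    simpa using h
  · rw [Finsupp.degree_eq_sum]
    simp [mul_add]
end
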